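/- The Virasoro symmetry group of KP₄ acts on solutions by reparametrization of time: let T : ℝ → ℝ be a smooth bijection with T'(t) > 0 for all t and smooth inverse S = T⁻¹, and let w : ℝ³ → ℝ be a smooth solution of the KP₄ equation. Define v : ℝ³ → ℝ by v(X, Y, τ) = T'(S(τ))^(−1/4) · w(X·T'(S(τ))^(−1/4), Y·T'(S(τ))^(−1/2), S(τ)) − (1/4)·X·Y·T''(S(τ))/T'(S(τ))². Then v is also a smooth solution of the KP₄ equation. (Equivalently: under t̃ = T(t), x̃ = x·T'(t)^(1/4), ỹ = y·T'(t)^(1/2), the function w̃ = T'(t)^(−1/4)·(w − (1/4)·x·y·T''(t)/T'(t)) solves KP₄, so x, y, w transform as tensors of weights 1/4, 1/2, −1/4 under time reparametrization.) -/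

import Mathlib

noncomputable section

/-- Partial derivative in the first variable `x`. -/
def dx (w : ℝ → ℝ → ℝ → ℝ) : ℝ → ℝ → ℝ → ℝ :=
  fun x y t => deriv (fun s => w s y t) x

/-- Partial derivative in the second variable `y`. -/
def dy (w : ℝ → ℝ → ℝ → ℝ) : ℝ → ℝ → ℝ → ℝ :=
  fun x y t => deriv (fun s => w x s t) y

/-- Partial derivative in the third variable `t`. -/
def dt (w : ℝ → ℝ → ℝ → ℝ) : ℝ → ℝ → ℝ → ℝ :=
  fun x y t => deriv (fun s => w x y s) t

/-- Smoothness of a function of three real variables. -/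
def Smooth3 (w : ℝ → ℝ → ℝ → ℝ) : Prop :=
  ContDiff ℝ (⊤ : ℕ∞) (fun p : ℝ × ℝ × ℝ => w p.1 p.2.1 p.2.2)

/-- The fourth equation of the KP hierarchy (KP₄). -/
def KP4 (w : ℝ → ℝ → ℝ → ℝ) : Prop :=
  ∀ x y t,
      dx (dx (dx (dx (dy w)))) x y t
    + 6 * dx (dx w) x y t * dx (dy w) x y t
    + 4 * dx w x y t * dx (dx (dy w)) x y t
    + 2 * dx (dx (dx w)) x y t * dy w x y t
    - 2 * dx (dx (dt w)) x y t
    + dy (dy (dy w)) x y t = 0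

/-- The linearization of the KP₄ equation at a solution `w`. -/
def LinKP4 (w Q : ℝ → ℝ → ℝ → ℝ) : Prop :=
  ∀ x y t,
      dx (dx (dx (dx (dy Q)))) x y t
    + 6 * (dx (dx Q) x y t * dx (dy w) x y t + dx (dx w) x y t * dx (dy Q) x y t)
    + 4 * (dx Q x y t * dx (dx (dy w)) x y t + dx w x y t * dx (dx (dy Q)) x y t)
    + 2 * (dx (dx (dx Q)) x y t * dy w x y t + dx (dx (dx w)) x y t * dy Q x y t)
    - 2 * dx (dx (dt Q)) x y t
    + dy (dy (dy Q)) x y t = 0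

theorem Smooth3.hasFDerivAt {w : ℝ → ℝ → ℝ → ℝ} (hw : Smooth3 w) (p : ℝ × ℝ × ℝ) :
    HasFDerivAt (fun p : ℝ × ℝ × ℝ => w p.1 p.2.1 p.2.2)
      (fderiv ℝ (fun p : ℝ × ℝ × ℝ => w p.1 p.2.1 p.2.2) p) p :=
  (ContDiff.differentiable hw (by simp) p).hasFDerivAt

theorem Smooth3.hasDerivAt_fderiv {w : ℝ → ℝ → ℝ → ℝ} (hw : Smooth3 w) {f g h : ℝ → ℝ}
    {f' g' h' s : ℝ} (hf : HasDerivAt f f' s) (hg : HasDerivAt g g' s) (hh : HasDerivAt h h' s) :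
    HasDerivAt (fun s => w (f s) (g s) (h s))
      (fderiv ℝ (fun p : ℝ × ℝ × ℝ => w p.1 p.2.1 p.2.2) (f s, g s, h s) (f', g', h')) s :=
  (hw.hasFDerivAt (f s, g s, h s)).comp_hasDerivAt (f := fun s => (f s, g s, h s)) s
    (hf.prodMk (hg.prodMk hh))

theorem Smooth3.dx_eq {w : ℝ → ℝ → ℝ → ℝ} (hw : Smooth3 w) (x y t : ℝ) :
    dx w x y t = fderiv ℝ (fun p : ℝ × ℝ × ℝ => w p.1 p.2.1 p.2.2) (x, y, t) (1, 0, 0) :=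
  (hw.hasDerivAt_fderiv (hasDerivAt_id x) (hasDerivAt_const x y) (hasDerivAt_const x t)).deriv

theorem Smooth3.dy_eq {w : ℝ → ℝ → ℝ → ℝ} (hw : Smooth3 w) (x y t : ℝ) :
    dy w x y t = fderiv ℝ (fun p : ℝ × ℝ × ℝ => w p.1 p.2.1 p.2.2) (x, y, t) (0, 1, 0) :=
  (hw.hasDerivAt_fderiv (hasDerivAt_const y x) (hasDerivAt_id y) (hasDerivAt_const y t)).deriv

theorem Smooth3.dt_eq {w : ℝ → ℝ → ℝ → ℝ} (hw : Smooth3 w) (x y t : ℝ) :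
    dt w x y t = fderiv ℝ (fun p : ℝ × ℝ × ℝ => w p.1 p.2.1 p.2.2) (x, y, t) (0, 0, 1) :=
  (hw.hasDerivAt_fderiv (hasDerivAt_const t x) (hasDerivAt_const t y) (hasDerivAt_id t)).deriv

theorem Smooth3.contDiff_fderiv_apply {w : ℝ → ℝ → ℝ → ℝ} (hw : Smooth3 w) (v : ℝ × ℝ × ℝ) :
    ContDiff ℝ (⊤ : ℕ∞)
      (fun p => fderiv ℝ (fun p : ℝ × ℝ × ℝ => w p.1 p.2.1 p.2.2) p v) :=
  (ContDiff.fderiv_right hw (by simp)).clm_apply contDiff_const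

theorem Smooth3.dx {w : ℝ → ℝ → ℝ → ℝ} (hw : Smooth3 w) : Smooth3 (dx w) := by
  simpa only [Smooth3, hw.dx_eq] using hw.contDiff_fderiv_apply (1, 0, 0)

theorem Smooth3.dy {w : ℝ → ℝ → ℝ → ℝ} (hw : Smooth3 w) : Smooth3 (dy w) := by
  simpa only [Smooth3, hw.dy_eq] using hw.contDiff_fderiv_apply (0, 1, 0)

theorem Smooth3.dt {w : ℝ → ℝ → ℝ → ℝ} (hw : Smooth3 w) : Smooth3 (dt w) := by
  simpa only [Smooth3, hw.dt_eq] using hw.contDiff_fderiv_apply (0, 0, 1)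

/-- The chain rule along a curve, in terms of partial derivatives. -/
theorem Smooth3.hasDerivAt_comp {w : ℝ → ℝ → ℝ → ℝ} (hw : Smooth3 w) {f g h : ℝ → ℝ}
    {f' g' h' s : ℝ} (hf : HasDerivAt f f' s) (hg : HasDerivAt g g' s) (hh : HasDerivAt h h' s) :
    HasDerivAt (fun s => w (f s) (g s) (h s))
      (f' * _root_.dx w (f s) (g s) (h s) + g' * _root_.dy w (f s) (g s) (h s)
        + h' * _root_.dt w (f s) (g s) (h s)) s := by
  convert hw.hasDerivAt_fderiv hf hg hh using 1
  rw [hw.dx_eq, hw.dy_eq, hw.dt_eq]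
  have hv : ((f', g', h') : ℝ × ℝ × ℝ)
      = f' • ((1, 0, 0) : ℝ × ℝ × ℝ) + g' • ((0, 1, 0) : ℝ × ℝ × ℝ)
        + h' • ((0, 0, 1) : ℝ × ℝ × ℝ) := by simp
  rw [hv, map_add, map_add, map_smul, map_smul, map_smul]
  simp only [smul_eq_mul]

theorem Smooth3.hasDerivAt_scale_fst {u : ℝ → ℝ → ℝ → ℝ} (hu : Smooth3 u) (k y t x : ℝ) :
    HasDerivAt (fun s => u (s * k) y t) (k * _root_.dx u (x * k) y t) x := by
  simpa using hu.hasDerivAt_comp ((hasDerivAt_id x).mul_const k) (hasDerivAt_const x y)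
    (hasDerivAt_const x t)

theorem Smooth3.hasDerivAt_scale_snd {u : ℝ → ℝ → ℝ → ℝ} (hu : Smooth3 u) (k x t y : ℝ) :
    HasDerivAt (fun s => u x (s * k) t) (k * _root_.dy u x (y * k) t) y := by
  simpa using hu.hasDerivAt_comp (hasDerivAt_const y x) ((hasDerivAt_id y).mul_const k)
    (hasDerivAt_const y t)

theorem dx_scale {u : ℝ → ℝ → ℝ → ℝ} (hu : Smooth3 u) (p a b S : ℝ → ℝ) :
    dx (fun x y t => p t * u (x * a t) (y * b t) (S t))
      = fun x y t => p t * a t * dx u (x * a t) (y * b t) (S t) := by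
  funext x y t
  exact ((hu.hasDerivAt_scale_fst (a t) (y * b t) (S t) x).const_mul (p t)).deriv.trans (by ring)

theorem dy_scale {u : ℝ → ℝ → ℝ → ℝ} (hu : Smooth3 u) (p a b S : ℝ → ℝ) :
    dy (fun x y t => p t * u (x * a t) (y * b t) (S t))
      = fun x y t => p t * b t * dy u (x * a t) (y * b t) (S t) := by
  funext x y t
  exact ((hu.hasDerivAt_scale_snd (b t) (x * a t) (S t) y).const_mul (p t)).deriv.trans (by ring)

/-- KP₄ is preserved by time reparametrization, written in terms of the scaling factor `a` of the
variable `x` and of `c = -a' / a`. -/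
theorem KP4.reparametrize {w : ℝ → ℝ → ℝ → ℝ} (hw : Smooth3 w) (hsol : KP4 w) {a c c' S : ℝ → ℝ}
    (ha : ∀ t, HasDerivAt a (-(c t * a t)) t) (hc : ∀ t, HasDerivAt c (c' t) t)
    (hS : ∀ t, HasDerivAt S (a t ^ 4) t) :
    KP4 (fun x y t => a t * w (x * a t) (y * a t ^ 2) (S t) - c t * x * y) := by
  have hx : dx (fun x y t => a t * w (x * a t) (y * a t ^ 2) (S t) - c t * x * y)
      = fun x y t => a t ^ 2 * dx w (x * a t) (y * a t ^ 2) (S t) - c t * y := by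
    funext x y t
    refine (((hw.hasDerivAt_scale_fst (a t) (y * a t ^ 2) (S t) x).const_mul (a t)).sub
      (((hasDerivAt_id x).const_mul (c t)).mul_const y)).deriv.trans ?_
    ring
  have hxx : dx (fun x y t => a t ^ 2 * dx w (x * a t) (y * a t ^ 2) (S t) - c t * y)
      = fun x y t => a t ^ 3 * dx (dx w) (x * a t) (y * a t ^ 2) (S t) := by
    funext x y t
    refine (((hw.dx.hasDerivAt_scale_fst (a t) (y * a t ^ 2) (S t) x).const_mul
      (a t ^ 2)).sub_const (c t * y)).deriv.trans ?_
    ring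
  have hy : dy (fun x y t => a t * w (x * a t) (y * a t ^ 2) (S t) - c t * x * y)
      = fun x y t => a t ^ 3 * dy w (x * a t) (y * a t ^ 2) (S t) - c t * x := by
    funext x y t
    refine (((hw.hasDerivAt_scale_snd (a t ^ 2) (x * a t) (S t) y).const_mul (a t)).sub
      ((hasDerivAt_id y).const_mul (c t * x))).deriv.trans ?_
    ring
  have hxy : dx (fun x y t => a t ^ 3 * dy w (x * a t) (y * a t ^ 2) (S t) - c t * x)
      = fun x y t => a t ^ 4 * dx (dy w) (x * a t) (y * a t ^ 2) (S t) - c t := by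
    funext x y t
    refine (((hw.dy.hasDerivAt_scale_fst (a t) (y * a t ^ 2) (S t) x).const_mul (a t ^ 3)).sub
      ((hasDerivAt_id x).const_mul (c t))).deriv.trans ?_
    ring
  have hxxy : dx (fun x y t => a t ^ 4 * dx (dy w) (x * a t) (y * a t ^ 2) (S t) - c t)
      = fun x y t => a t ^ 5 * dx (dx (dy w)) (x * a t) (y * a t ^ 2) (S t) := by
    funext x y t
    refine (((hw.dy.dx.hasDerivAt_scale_fst (a t) (y * a t ^ 2) (S t) x).const_mul
      (a t ^ 4)).sub_const (c t)).deriv.trans ?_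
    ring
  have hyy : dy (fun x y t => a t ^ 3 * dy w (x * a t) (y * a t ^ 2) (S t) - c t * x)
      = fun x y t => a t ^ 5 * dy (dy w) (x * a t) (y * a t ^ 2) (S t) := by
    funext x y t
    refine (((hw.dy.hasDerivAt_scale_snd (a t ^ 2) (x * a t) (S t) y).const_mul
      (a t ^ 3)).sub_const (c t * x)).deriv.trans ?_
    ring
  have ht : dt (fun x y t => a t * w (x * a t) (y * a t ^ 2) (S t) - c t * x * y)
      = fun x y t => -(c t * a t) * w (x * a t) (y * a t ^ 2) (S t)
          - c t * a t ^ 2 * (x * dx w (x * a t) (y * a t ^ 2) (S t))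
          - 2 * c t * a t ^ 3 * y * dy w (x * a t) (y * a t ^ 2) (S t)
          + a t ^ 5 * dt w (x * a t) (y * a t ^ 2) (S t) - c' t * y * x := by
    funext x y t
    refine (((ha t).mul (hw.hasDerivAt_comp ((ha t).const_mul x) (((ha t).pow 2).const_mul y)
      (hS t))).sub (((hc t).mul_const x).mul_const y)).deriv.trans ?_
    simp only [Pi.pow_apply]
    push_cast
    ring
  have hxt : dx (fun x y t => -(c t * a t) * w (x * a t) (y * a t ^ 2) (S t)
          - c t * a t ^ 2 * (x * dx w (x * a t) (y * a t ^ 2) (S t))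
          - 2 * c t * a t ^ 3 * y * dy w (x * a t) (y * a t ^ 2) (S t)
          + a t ^ 5 * dt w (x * a t) (y * a t ^ 2) (S t) - c' t * y * x)
      = fun x y t => -2 * c t * a t ^ 2 * dx w (x * a t) (y * a t ^ 2) (S t)
          - c t * a t ^ 3 * (x * dx (dx w) (x * a t) (y * a t ^ 2) (S t))
          - 2 * c t * a t ^ 4 * y * dx (dy w) (x * a t) (y * a t ^ 2) (S t)
          + a t ^ 6 * dx (dt w) (x * a t) (y * a t ^ 2) (S t) - c' t * y := by
    funext x y t
    have key {u : ℝ → ℝ → ℝ → ℝ} (hu : Smooth3 u) :=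
      hu.hasDerivAt_scale_fst (a t) (y * a t ^ 2) (S t) x
    refine ((((((key hw).const_mul (-(c t * a t))).sub
      (((hasDerivAt_id x).mul (key hw.dx)).const_mul (c t * a t ^ 2))).sub
      ((key hw.dy).const_mul (2 * c t * a t ^ 3 * y))).add
      ((key hw.dt).const_mul (a t ^ 5))).sub
      ((hasDerivAt_id x).const_mul (c' t * y))).deriv.trans ?_
    simp only [id]
    ring
  have hxxt : dx (fun x y t => -2 * c t * a t ^ 2 * dx w (x * a t) (y * a t ^ 2) (S t)
          - c t * a t ^ 3 * (x * dx (dx w) (x * a t) (y * a t ^ 2) (S t))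
          - 2 * c t * a t ^ 4 * y * dx (dy w) (x * a t) (y * a t ^ 2) (S t)
          + a t ^ 6 * dx (dt w) (x * a t) (y * a t ^ 2) (S t) - c' t * y)
      = fun x y t => -3 * c t * a t ^ 3 * dx (dx w) (x * a t) (y * a t ^ 2) (S t)
          - c t * a t ^ 4 * (x * dx (dx (dx w)) (x * a t) (y * a t ^ 2) (S t))
          - 2 * c t * a t ^ 5 * y * dx (dx (dy w)) (x * a t) (y * a t ^ 2) (S t)
          + a t ^ 7 * dx (dx (dt w)) (x * a t) (y * a t ^ 2) (S t) := by
    funext x y t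
    have key {u : ℝ → ℝ → ℝ → ℝ} (hu : Smooth3 u) :=
      hu.hasDerivAt_scale_fst (a t) (y * a t ^ 2) (S t) x
    refine ((((((key hw.dx).const_mul (-2 * c t * a t ^ 2)).sub
      (((hasDerivAt_id x).mul (key hw.dx.dx)).const_mul (c t * a t ^ 3))).sub
      ((key hw.dy.dx).const_mul (2 * c t * a t ^ 4 * y))).add
      ((key hw.dt.dx).const_mul (a t ^ 6))).sub_const (c' t * y)).deriv.trans ?_
    simp only [id]
    ring
  have scale_dx {u : ℝ → ℝ → ℝ → ℝ} (hu : Smooth3 u) (n : ℕ) :=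
    dx_scale hu (fun t => a t ^ n) a (fun t => a t ^ 2) S
  have scale_dy {u : ℝ → ℝ → ℝ → ℝ} (hu : Smooth3 u) (n : ℕ) :=
    dy_scale hu (fun t => a t ^ n) a (fun t => a t ^ 2) S
  intro x y t
  rw [hx, hxx, hy, hxy, hxxy, hyy, ht, hxt, hxxt, scale_dx hw.dx.dx, scale_dx hw.dy.dx.dx,
    scale_dy hw.dy.dy]
  simp only [← pow_succ]
  rw [scale_dx hw.dy.dx.dx.dx]
  linear_combination a t ^ 7 * hsol (x * a t) (y * a t ^ 2) (S t)

/-- The finite Virasoro group transformation (time reparametrization) of KP₄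
maps solutions to solutions: `x, y, w` transform as tensors of weights
`1/4, 1/2, −1/4` under a reparametrization `t ↦ T(t)` of time. -/
theorem stmt19 (T S : ℝ → ℝ) (hT : ContDiff ℝ (⊤ : ℕ∞) T) (hTbij : Function.Bijective T)
    (hT' : ∀ t, 0 < deriv T t) (hS : ContDiff ℝ (⊤ : ℕ∞) S)
    (hST : Function.LeftInverse S T) (hTS : Function.RightInverse S T)
    (w : ℝ → ℝ → ℝ → ℝ) (hw : Smooth3 w) (hsol : KP4 w) :
    Smooth3 (fun X Y τ =>
      (deriv T (S τ)) ^ (-(1/4) : ℝ)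
        * w (X * (deriv T (S τ)) ^ (-(1/4) : ℝ)) (Y * (deriv T (S τ)) ^ (-(1/2) : ℝ)) (S τ)
      - (1/4) * X * Y * deriv (deriv T) (S τ) / (deriv T (S τ)) ^ 2) ∧
    KP4 (fun X Y τ =>
      (deriv T (S τ)) ^ (-(1/4) : ℝ)
        * w (X * (deriv T (S τ)) ^ (-(1/4) : ℝ)) (Y * (deriv T (S τ)) ^ (-(1/2) : ℝ)) (S τ)
      - (1/4) * X * Y * deriv (deriv T) (S τ) / (deriv T (S τ)) ^ 2) := by
  have hdT : ContDiff ℝ (⊤ : ℕ∞) (deriv T) := (contDiff_infty_iff_deriv.1 hT).2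
  have hddT : ContDiff ℝ (⊤ : ℕ∞) (deriv (deriv T)) :=
    (contDiff_infty_iff_deriv.1 hdT).2
  have hpos : ∀ t, 0 < deriv T (S t) := fun t => hT' (S t)
  have hne : ∀ t, deriv T (S t) ≠ 0 := fun t => (hpos t).ne'
  have hdTS : ContDiff ℝ (⊤ : ℕ∞) (fun t => deriv T (S t)) := hdT.comp hS
  have hddTS : ContDiff ℝ (⊤ : ℕ∞) (fun t => deriv (deriv T) (S t)) := hddT.comp hS
  set a : ℝ → ℝ := fun t => deriv T (S t) ^ (-(1/4) : ℝ) with ha_def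
  set c : ℝ → ℝ := fun t => 1 / 4 * (deriv (deriv T) (S t) / deriv T (S t) ^ 2) with hc_def
  have ha : ContDiff ℝ (⊤ : ℕ∞) a := hdTS.rpow_const_of_ne hne
  have hc : ContDiff ℝ (⊤ : ℕ∞) c :=
    contDiff_const.mul (hddTS.div (hdTS.pow 2) fun t => pow_ne_zero 2 (hne t))
  have ha2 : ∀ t, deriv T (S t) ^ (-(1/2) : ℝ) = a t ^ 2 := fun t => by
    rw [ha_def, ← Real.rpow_mul_natCast (hpos t).le]
    norm_num
  have ha4 : ∀ t, a t ^ 4 = (deriv T (S t))⁻¹ := fun t => by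
    rw [ha_def, ← Real.rpow_mul_natCast (hpos t).le, ← Real.rpow_neg_one]
    norm_num
  have hS' : ∀ t, HasDerivAt S (a t ^ 4) t := fun t => by
    rw [ha4]
    exact HasDerivAt.of_local_left_inverse hS.continuous.continuousAt
      (hT.differentiable (by simp) (S t)).hasDerivAt (hne t) (Filter.Eventually.of_forall hTS)
  have ha' : ∀ t, HasDerivAt a (-(c t * a t)) t := fun t => by
    have h := ((hdT.differentiable (by simp) (S t)).hasDerivAt.comp t (hS' t)).rpow_const
      (p := (-(1/4) : ℝ)) (Or.inl (hne t))
    refine h.congr_deriv ?_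
    simp only [Function.comp_apply]
    rw [Real.rpow_sub_one (hne t), ha4]
    have := hne t
    simp only [ha_def, hc_def]
    field_simp
  have hc' : ∀ t, HasDerivAt c (deriv c t) t := fun t =>
    (hc.differentiable (by simp) t).hasDerivAt
  have hv : (fun X Y τ : ℝ =>
      (deriv T (S τ)) ^ (-(1/4) : ℝ)
        * w (X * (deriv T (S τ)) ^ (-(1/4) : ℝ)) (Y * (deriv T (S τ)) ^ (-(1/2) : ℝ)) (S τ)
      - (1/4) * X * Y * deriv (deriv T) (S τ) / (deriv T (S τ)) ^ 2)
      = fun X Y τ => a τ * w (X * a τ) (Y * a τ ^ 2) (S τ) - c τ * X * Y := by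
    funext X Y τ
    rw [ha2]
    simp only [ha_def, hc_def]
    ring
  rw [hv]
  refine ⟨?_, hsol.reparametrize hw ha' hc' hS'⟩
  have hw' : ContDiff ℝ (⊤ : ℕ∞) (fun p : ℝ × ℝ × ℝ => w p.1 p.2.1 p.2.2) := hw
  have hp : ContDiff ℝ (⊤ : ℕ∞) (fun p : ℝ × ℝ × ℝ =>
      (p.1 * a p.2.2, p.2.1 * a p.2.2 ^ 2, S p.2.2)) := by fun_prop
  have hcomp := hw'.comp hp
  exact ((ha.comp (contDiff_snd.comp contDiff_snd)).mul hcomp).sub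
    (((hc.comp (contDiff_snd.comp contDiff_snd)).mul contDiff_fst).mul
      (contDiff_fst.comp contDiff_snd))
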